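/- Let G = (V,E) be a finite connected simple graph with at least one edge, and consider the simple random walk (w_0, w_1, w_2, …) started at an arbitrary vertex u ∈ V, where each step moves to a uniformly random neighbor of the current vertex. Let T = inf{ t ≥ 0 : {w_0, …, w_t} = V } be the cover time, i.e., the first time at which every vertex of G has been visited. Then E[T] ≤ 4·|V|·|E|. -/

import Mathlib

open MeasureTheory

namespace CoverTime

variable {V : Type*} [Fintype V] [DecidableEq V]

/-- truncated expected hitting time of `b` -/
noncomputable def hit (P : V → V → ENNReal) (b : V) : ℕ → V → ENNReal
  | 0, _ => 0
  | k + 1, x => if x = b then 0 else 1 + ∑ y, P x y * hit P b k y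

theorem hit_mono_succ (P : V → V → ENNReal) (b : V) (k : ℕ) (x : V) :
    hit P b k x ≤ hit P b (k + 1) x := by
  induction k generalizing x with
  | zero => simp [hit]
  | succ k ih =>
    rw [hit, hit]
    split_ifs
    · exact le_rfl
    · gcongr with y
      exact ih y

theorem hit_mono (P : V → V → ENNReal) (b : V) : Monotone (hit P b) :=
  monotone_nat_of_le_succ fun k x => hit_mono_succ P b k x

theorem hit_le (P : V → V → ENNReal) (hs : ∀ x, ∑ y, P x y ≤ 1) (b : V) (k : ℕ) (x : V) :
    hit P b k x ≤ k := by
  induction k generalizing x with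
  | zero => simp [hit]
  | succ k ih =>
    rw [hit]
    split_ifs
    · exact zero_le
    · calc 1 + ∑ y, P x y * hit P b k y ≤ 1 + ∑ y, P x y * k := by
            gcongr with y; exact ih y
        _ = 1 + (∑ y, P x y) * k := by rw [Finset.sum_mul]
        _ ≤ 1 + 1 * k := by gcongr; exact hs x
        _ = ((k + 1 : ℕ) : ENNReal) := by push_cast; ring

noncomputable def hitLim (P : V → V → ENNReal) (b : V) (x : V) : ENNReal := ⨆ k, hit P b k x

theorem hitLim_self (P : V → V → ENNReal) (b : V) : hitLim P b b = 0 := by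
  simp only [hitLim, ENNReal.iSup_eq_zero]
  intro k
  cases k <;> simp [hit]

theorem hitLim_step (P : V → V → ENNReal) (b x : V) (hx : x ≠ b) :
    1 + ∑ y, P x y * hitLim P b y ≤ hitLim P b x := by
  have : 1 + ∑ y, P x y * hitLim P b y = ⨆ k, hit P b (k + 1) x := by
    simp only [hit, if_neg hx, hitLim, ENNReal.mul_iSup]
    rw [ENNReal.finsetSum_iSup_of_monotone, ENNReal.add_iSup]
    intro y i j hij
    have := hit_mono P b hij y
    dsimp only
    gcongr
  rw [this]
  exact iSup_le fun k => le_iSup (fun k => hit P b k x) (k + 1)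

section graph
variable (G : SimpleGraph V) [DecidableRel G.Adj] (P : V → V → ENNReal)
    (hP : ∀ a b : V, P a b = if G.Adj a b then ((G.degree a : ENNReal))⁻¹ else 0)

include hP in
theorem sum_P_le (x : V) : ∑ y, P x y ≤ 1 := by
  simp only [hP]
  rw [← Finset.sum_filter, Finset.sum_const, ← SimpleGraph.neighborFinset_eq_filter,
    SimpleGraph.card_neighborFinset_eq_degree, nsmul_eq_mul]
  exact ENNReal.mul_inv_le_one _

include hP in
theorem deg_mul_P_le (x y : V) : (G.degree x : ENNReal) * P x y ≤ if G.Adj x y then 1 else 0 := by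
  rw [hP]
  split_ifs
  · exact ENNReal.mul_inv_le_one _
  · simp

include hP in
theorem hit_adj_le (a b : V) (hab : G.Adj a b) (k : ℕ) :
    hit P b k a ≤ 2 * G.edgeFinset.card := by
  have hs := sum_P_le G P hP
  let A : V → V → ENNReal := fun x y => if G.Adj x y then 1 else 0
  have hdeg : ∀ y, ∑ x, A x y = G.degree y := by
    intro y
    simp only [A]
    rw [Finset.sum_boole, ← SimpleGraph.card_neighborFinset_eq_degree,
      SimpleGraph.neighborFinset_eq_filter]
    simp [SimpleGraph.adj_comm]
  set S : ENNReal := ∑ x, (G.degree x : ENNReal) * hit P b k x with hS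
  have hfin : S ≠ ⊤ := by
    refine ENNReal.sum_ne_top.2 fun x _ => ENNReal.mul_ne_top (by simp) ?_
    exact ne_top_of_le_ne_top (by simp) (hit_le P hs b k x)
  have h2m : ∑ x, (G.degree x : ENNReal) = 2 * G.edgeFinset.card := by
    exact_mod_cast congrArg (Nat.cast : ℕ → ENNReal) G.sum_degrees_eq_twice_card_edges
  have key : S + ∑ y, A b y * hit P b k y ≤ S + 2 * G.edgeFinset.card := by
    calc S + ∑ y, A b y * hit P b k y
        ≤ ∑ x, (G.degree x : ENNReal) * hit P b (k+1) x + ∑ y, A b y * hit P b k y := by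
          rw [hS]
          exact add_le_add (Finset.sum_le_sum fun x _ => mul_le_mul_right (hit_mono_succ P b k x) _) le_rfl
      _ = ∑ x, ((G.degree x : ENNReal) * hit P b (k+1) x
            + if x = b then ∑ y, A x y * hit P b k y else 0) := by
          rw [Finset.sum_add_distrib]; simp
      _ ≤ ∑ x, ((G.degree x : ENNReal) + ∑ y, A x y * hit P b k y) := by
          refine Finset.sum_le_sum fun x _ => ?_
          rw [hit]
          split_ifs
          · simp
          · rw [mul_add, Finset.mul_sum, mul_one, add_zero]
            refine add_le_add le_rfl (Finset.sum_le_sum fun y _ => ?_)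
            rw [← mul_assoc]
            exact mul_le_mul_left (deg_mul_P_le G P hP x y) _
      _ = 2 * G.edgeFinset.card + S := by
          rw [Finset.sum_add_distrib, h2m, Finset.sum_comm]
          congr 1
          refine Finset.sum_congr rfl fun y _ => ?_
          rw [← Finset.sum_mul, hdeg]
      _ = _ := add_comm _ _
  have h3 := (ENNReal.add_le_add_iff_left hfin).1 key
  refine le_trans ?_ h3
  have : hit P b k a = A b a * hit P b k a := by simp [A, hab.symm]
  rw [this]
  exact Finset.single_le_sum (f := fun y => A b y * hit P b k y) (fun _ _ => zero_le)
    (Finset.mem_univ a)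

include hP in
theorem hitLim_adj_le (a b : V) (hab : G.Adj a b) :
    hitLim P b a ≤ 2 * G.edgeFinset.card :=
  iSup_le fun k => hit_adj_le G P hP a b hab k

/-- remove the head if it is the current vertex -/
def strip : List V → V → List V
  | [], _ => []
  | v :: l, x => if v = x then l else v :: l

/-- potential -/
noncomputable def pot (c : ENNReal) : List V → V → ENNReal
  | [], _ => 0
  | v :: l, x => hitLim P v x + c * l.length

def Good (l : List V) (x : V) : Prop := l.IsChain G.Adj ∧ ∀ v ∈ l.head?, v ≠ x

omit [Fintype V] [DecidableRel G.Adj] in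
theorem good_strip (l : List V) (hl : l.IsChain G.Adj) (x : V) : Good G (strip l x) x := by
  cases l with
  | nil => simp [strip, Good]
  | cons v l =>
    rw [strip]
    split_ifs with h
    · subst h
      cases l with
      | nil => simp [Good]
      | cons w l =>
        simp only [List.isChain_cons_cons] at hl
        refine ⟨hl.2, ?_⟩
        simpa using hl.1.ne'
    · exact ⟨hl, by simpa using h⟩

include hP in
theorem pot_strip_le (l : List V) (hl : l.IsChain G.Adj) (x : V) :
    pot P (2 * G.edgeFinset.card) (strip l x) x ≤ pot P (2 * G.edgeFinset.card) l x := by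
  cases l with
  | nil => simp [strip]
  | cons v l =>
    rw [strip]
    split_ifs with h
    · subst h
      cases l with
      | nil => simp [pot]
      | cons w l =>
        simp only [List.isChain_cons_cons] at hl
        have := hitLim_adj_le G P hP v w hl.1
        simp only [pot, hitLim_self, List.length_cons]
        push_cast
        rw [mul_add, mul_one, zero_add, add_comm]
        gcongr
    · exact le_rfl

include hP in
theorem pot_step (l : List V) (x : V) (hl : Good G l x) :
    (if l = [] then 0 else 1) + ∑ y, P x y * pot P (2 * G.edgeFinset.card) (strip l y) y
      ≤ pot P (2 * G.edgeFinset.card) l x := by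
  cases l with
  | nil => simp [pot, strip]
  | cons v l =>
    have hx : x ≠ v := by simpa [eq_comm] using hl.2 v (by simp)
    set c : ENNReal := 2 * G.edgeFinset.card with hc
    calc _ ≤ 1 + ∑ y, P x y * pot P c (v :: l) y := by
          rw [if_neg (by simp)]
          gcongr with y
          exact pot_strip_le G P hP _ hl.1 y
      _ = (1 + ∑ y, P x y * hitLim P v y) + (∑ y, P x y) * (c * l.length) := by
          simp only [pot, mul_add, Finset.sum_add_distrib, Finset.sum_mul, add_assoc]
      _ ≤ hitLim P v x + 1 * (c * l.length) := by
          gcongr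
          · exact hitLim_step P v x hx
          · exact sum_P_le G P hP x
      _ = _ := by rw [one_mul, pot]

/-- remaining list at time t -/
def rem (l : List V) (ω : ℕ → V) : ℕ → List V
  | 0 => strip l (ω 0)
  | t + 1 => strip (rem l ω t) (ω (t + 1))

omit [Fintype V] [DecidableRel G.Adj] in
theorem good_rem (l : List V) (hl : l.IsChain G.Adj) (ω : ℕ → V) (t : ℕ) :
    Good G (rem l ω t) (ω t) := by
  induction t with
  | zero => exact good_strip G l hl _
  | succ t ih => exact good_strip G _ ih.1 _

omit [Fintype V] in
theorem rem_congr (l : List V) (ω ω' : ℕ → V) (t : ℕ) (h : ∀ i ≤ t, ω i = ω' i) :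
    rem l ω t = rem l ω' t := by
  induction t with
  | zero => rw [rem, rem, h 0 le_rfl]
  | succ t ih => rw [rem, rem, h (t+1) le_rfl, ih fun i hi => h i (by omega)]

omit [Fintype V] in
theorem mem_strip (l : List V) (x v : V) (hv : v ∈ l) : v = x ∨ v ∈ strip l x := by
  cases l with
  | nil => simp at hv
  | cons w l =>
    rw [strip]
    split_ifs with h
    · subst h; simpa using hv
    · exact Or.inr hv

omit [Fintype V] in
theorem mem_rem (l : List V) (ω : ℕ → V) (v : V) (hv : v ∈ l) (t : ℕ) :
    (∃ i ≤ t, ω i = v) ∨ v ∈ rem l ω t := by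
  induction t with
  | zero =>
    rcases mem_strip l (ω 0) v hv with h | h
    · exact Or.inl ⟨0, le_rfl, h.symm⟩
    · exact Or.inr h
  | succ t ih =>
    rcases ih with ⟨i, hi, h⟩ | h
    · exact Or.inl ⟨i, by omega, h⟩
    · rcases mem_strip _ (ω (t+1)) v h with h | h
      · exact Or.inl ⟨t+1, le_rfl, h.symm⟩
      · exact Or.inr h

omit [Fintype V] in
theorem cover_le (l : List V) (hl : ∀ v, v ∈ l) (ω : ℕ → V) :
    (⨅ (t : ℕ) (_ : ∀ v : V, ∃ i ≤ t, ω i = v), (t : ENNReal)) ≤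
      ∑' t, if rem l ω t = [] then 0 else 1 := by
  by_cases h : ∃ t, rem l ω t = []
  · classical
    let t := Nat.find h
    have ht : rem l ω t = [] := Nat.find_spec h
    refine (iInf₂_le t fun v => ?_).trans ?_
    · rcases mem_rem l ω v (hl v) t with h | h
      · exact h
      · simp [ht] at h
    · refine le_trans (le_of_eq ?_) (ENNReal.sum_le_tsum (Finset.range t))
      rw [Finset.sum_congr rfl (g := fun _ => 1)]
      · simp
      · intro i hi
        exact if_neg (Nat.find_min h (Finset.mem_range.1 hi))
  · push Not at h
    simp [h, ENNReal.tsum_const_eq_top_of_ne_zero]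

omit [Fintype V] [DecidableRel G.Adj] in
theorem exists_walk_aux [Finite V] (hconn : G.Connected) (u : V) (k : ℕ) :
    ∃ p : G.Walk u u, p.length ≤ 2 * k ∧ ((∀ v, v ∈ p.support) ∨ k + 1 ≤ p.support.toFinset.card) := by
  induction k with
  | zero => exact ⟨.nil, by simp, by simp⟩
  | succ k ih =>
    obtain ⟨p, hp, h⟩ := ih
    by_cases hall : ∀ v, v ∈ p.support
    · exact ⟨p, by omega, Or.inl hall⟩
    have h := h.resolve_left hall
    push Not at hall
    obtain ⟨v, hv⟩ := hall
    obtain ⟨q⟩ := hconn.preconnected u v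
    obtain ⟨d, -, hd1, hd2⟩ := q.exists_boundary_dart {x | x ∈ p.support} (by simp) hv
    simp only [Set.mem_setOf_eq] at hd1 hd2
    refine ⟨(p.takeUntil _ hd1).append (.cons d.adj (.cons d.adj.symm (p.dropUntil _ hd1))), ?_,
      Or.inr ?_⟩
    · have := congrArg SimpleGraph.Walk.length (p.take_spec hd1)
      simp only [SimpleGraph.Walk.length_append, SimpleGraph.Walk.length_cons] at *
      omega
    · have hsub : insert d.snd p.support.toFinset ⊆ ((p.takeUntil _ hd1).append
          (.cons d.adj (.cons d.adj.symm (p.dropUntil _ hd1)))).support.toFinset := by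
        intro x hx
        rw [Finset.mem_insert, List.mem_toFinset] at hx
        rw [List.mem_toFinset, SimpleGraph.Walk.mem_support_append_iff]
        rcases hx with rfl | hx
        · right; simp
        · rw [← p.take_spec hd1, SimpleGraph.Walk.mem_support_append_iff] at hx
          rcases hx with hx | hx
          · exact Or.inl hx
          · right; simp [hx]
      have := Finset.card_le_card hsub
      rw [Finset.card_insert_of_notMem (by simpa using hd2)] at this
      omega

omit [DecidableRel G.Adj] in
theorem exists_walk (hconn : G.Connected) (u : V) :
    ∃ p : G.Walk u u, p.length ≤ 2 * Fintype.card V ∧ ∀ v, v ∈ p.support := by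
  obtain ⟨p, hp, h⟩ := exists_walk_aux G hconn u (Fintype.card V)
  refine ⟨p, hp, h.resolve_right ?_⟩
  have := Finset.card_le_univ p.support.toFinset
  omega

end graph

section meas
variable [MeasurableSpace V] [MeasurableSingletonClass V]

/-- restriction to first coordinates -/
def res (t : ℕ) (ω : ℕ → V) : Fin (t + 1) → V := fun i => ω i

/-- extension -/
def ext (t : ℕ) (w : Fin (t + 1) → V) : ℕ → V := fun i => w ⟨min i t, by omega⟩

omit [Fintype V] [DecidableEq V] [MeasurableSpace V] [MeasurableSingletonClass V] in
theorem ext_res (t : ℕ) (ω : ℕ → V) (i : ℕ) (hi : i ≤ t) : ω i = ext t (res t ω) i := by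
  simp [ext, res, hi]

omit [Fintype V] [DecidableEq V] [MeasurableSingletonClass V] in
theorem measurable_res (t : ℕ) : Measurable (res (V := V) t) :=
  measurable_pi_lambda _ fun i => measurable_pi_apply _

omit [Fintype V] [DecidableEq V] [MeasurableSpace V] [MeasurableSingletonClass V] in
theorem res_eq_iff (t : ℕ) (ω : ℕ → V) (w : Fin (t + 1) → V) :
    res t ω = w ↔ ∀ i ≤ t, ω i = ext t w i := by
  constructor
  · rintro rfl i hi; exact ext_res t ω i hi
  · intro h
    funext i
    have := h i (by omega)
    rw [res, this, ext]
    congr 1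
    ext
    simp; omega

theorem markov (μ : Measure (ℕ → V)) (P : V → V → ENNReal) (u : V)
    (hμ : ∀ (t : ℕ) (w : ℕ → V),
      μ {ω | ∀ i ≤ t, ω i = w i} =
        (if w 0 = u then 1 else 0) * ∏ i ∈ Finset.range t, P (w i) (w (i + 1)))
    (t : ℕ) (g : (Fin (t + 1) → V) → V → ENNReal) :
    ∫⁻ ω, g (res t ω) (ω (t + 1)) ∂μ = ∫⁻ ω, ∑ y, P (ω t) y * g (res t ω) y ∂μ := by
  have h1 : ∫⁻ ω, g (res t ω) (ω (t + 1)) ∂μ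
      = ∑ w, ∑ y, g w y * μ {ω | res t ω = w ∧ ω (t + 1) = y} := by
    have hm : Measurable fun ω : ℕ → V => (res t ω, ω (t + 1)) :=
      (measurable_res t).prodMk (measurable_pi_apply _)
    have := lintegral_map (μ := μ) (f := fun q : (Fin (t+1) → V) × V => g q.1 q.2)
      (Measurable.of_discrete) hm
    rw [← this, lintegral_fintype, Fintype.sum_prod_type]
    refine Finset.sum_congr rfl fun w _ => Finset.sum_congr rfl fun y _ => ?_
    rw [Measure.map_apply hm (measurableSet_singleton _)]
    congr 2
    ext ω
    simp
  have h2 : ∫⁻ ω, ∑ y, P (ω t) y * g (res t ω) y ∂μ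
      = ∑ w, (∑ y, P (w (Fin.last t)) y * g w y) * μ {ω | res t ω = w} := by
    have := lintegral_map (μ := μ)
      (f := fun w : (Fin (t+1) → V) => ∑ y, P (w (Fin.last t)) y * g w y)
      (Measurable.of_discrete) (measurable_res t)
    rw [lintegral_fintype] at this
    have h' : ∀ ω : ℕ → V, res t ω (Fin.last t) = ω t := fun ω => by simp [res]
    simp only [h'] at this
    rw [← this]
    refine Finset.sum_congr rfl fun w _ => ?_
    rw [Measure.map_apply (measurable_res t) (measurableSet_singleton _)]
    rfl
  rw [h1, h2]
  refine Finset.sum_congr rfl fun w _ => ?_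
  rw [Finset.sum_mul]
  refine Finset.sum_congr rfl fun y _ => ?_
  let w' : ℕ → V := fun i => if i ≤ t then ext t w i else y
  have e1 : {ω | res t ω = w ∧ ω (t + 1) = y} = {ω | ∀ i ≤ t + 1, ω i = w' i} := by
    ext ω
    simp only [Set.mem_setOf_eq, res_eq_iff, w']
    constructor
    · rintro ⟨h, h'⟩ i hi
      split_ifs with hit
      · exact h i hit
      · obtain rfl : i = t + 1 := by omega
        exact h'
    · intro h
      refine ⟨fun i hi => ?_, ?_⟩
      · have := h i (by omega)
        rwa [if_pos hi] at this
      · have := h (t+1) le_rfl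
        rwa [if_neg (by omega)] at this
  have e2 : {ω | res t ω = w} = {ω | ∀ i ≤ t, ω i = w' i} := by
    ext ω
    simp only [Set.mem_setOf_eq, res_eq_iff, w']
    refine forall₂_congr fun i hi => ?_
    rw [if_pos hi]
  rw [e1, e2, hμ, hμ, Finset.prod_range_succ]
  have e3 : w' t = w (Fin.last t) := by simp [w', ext, Fin.last]
  have e4 : w' (t + 1) = y := by simp [w']
  rw [e3, e4]
  ring

end meas

end CoverTime

/-- The expected cover time of the simple random walk on a finite connected simple
graph with at least one edge, started at any vertex `u`, is at most `4·|V|·|E|`.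
The walk is modeled as a probability measure `μ` on `ℕ → V` whose cylinder
probabilities are those of the Markov chain started at `u` with transition
probabilities `P`. -/
theorem cover_time_expectation_le
    {V : Type*} [Fintype V] [DecidableEq V]
    [MeasurableSpace V] [MeasurableSingletonClass V]
    (G : SimpleGraph V) [DecidableRel G.Adj]
    (hconn : G.Connected)
    (hedge : 0 < G.edgeFinset.card)
    (u : V)
    (μ : Measure (ℕ → V)) [IsProbabilityMeasure μ]
    (P : V → V → ENNReal)
    (hP : ∀ a b : V, P a b = if G.Adj a b then ((G.degree a : ENNReal))⁻¹ else 0)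
    (hμ : ∀ (t : ℕ) (w : ℕ → V),
      μ {ω | ∀ i ≤ t, ω i = w i} =
        (if w 0 = u then 1 else 0) * ∏ i ∈ Finset.range t, P (w i) (w (i + 1)))
    (T : (ℕ → V) → ENNReal)
    (hT : ∀ ω : ℕ → V,
      T ω = ⨅ (t : ℕ) (_ : ∀ v : V, ∃ i ≤ t, ω i = v), (t : ENNReal)) :
    (∫⁻ ω, T ω ∂μ) ≤ 4 * (Fintype.card V : ENNReal) * (G.edgeFinset.card : ENNReal) := by
  classical
  obtain ⟨p, hp, hcov⟩ := CoverTime.exists_walk G hconn u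
  set l := p.support with hl
  have hchain : l.IsChain G.Adj := p.isChain_adj_support
  set c : ENNReal := 2 * G.edgeFinset.card with hc
  have hfac : ∀ t (ω : ℕ → V), CoverTime.rem l ω t =
      CoverTime.rem l (CoverTime.ext t (CoverTime.res t ω)) t := fun t ω =>
    CoverTime.rem_congr l _ _ t fun i hi => CoverTime.ext_res t ω i hi
  let N : ℕ → (ℕ → V) → ENNReal := fun t ω => if CoverTime.rem l ω t = [] then 0 else 1
  have hN : ∀ t, Measurable (N t) := by
    intro t
    have : N t = (fun w => if CoverTime.rem l (CoverTime.ext t w) t = [] then 0 else 1) ∘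
        CoverTime.res t := by
      funext ω
      simp only [N, Function.comp]
      rw [hfac t ω]
    rw [this]
    exact Measurable.comp Measurable.of_discrete (CoverTime.measurable_res t)
  let g : ℕ → (ℕ → V) → ENNReal := fun t ω => CoverTime.pot P c (CoverTime.rem l ω t) (ω t)
  have hstep : ∀ t, ∫⁻ ω, N t ω ∂μ + ∫⁻ ω, g (t + 1) ω ∂μ ≤ ∫⁻ ω, g t ω ∂μ := by
    intro t
    have e : ∫⁻ ω, g (t + 1) ω ∂μ = ∫⁻ ω, ∑ y, P (ω t) y *
        CoverTime.pot P c (CoverTime.strip (CoverTime.rem l ω t) y) y ∂μ := by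
      have := CoverTime.markov μ P u hμ t (fun w y =>
        CoverTime.pot P c (CoverTime.strip (CoverTime.rem l (CoverTime.ext t w) t) y) y)
      simp only [← hfac] at this
      exact this
    rw [e, ← lintegral_add_left (hN t)]
    exact lintegral_mono fun ω =>
      CoverTime.pot_step G P hP _ _ (CoverTime.good_rem G l hchain ω t)
  have hsum : ∀ t, ∑ i ∈ Finset.range t, ∫⁻ ω, N i ω ∂μ + ∫⁻ ω, g t ω ∂μ ≤ ∫⁻ ω, g 0 ω ∂μ := by
    intro t
    induction t with
    | zero => simp
    | succ t ih =>
      rw [Finset.sum_range_succ, add_assoc]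
      exact (add_le_add le_rfl (hstep t)).trans ih
  have h0 : μ {ω | ω 0 = u} = 1 := by
    have := hμ 0 (fun _ => u)
    simpa using this
  have hae : ∀ᵐ ω ∂μ, ω 0 = u := by
    have hm : MeasurableSet {ω : ℕ → V | ω 0 = u} :=
      measurableSet_eq_fun (measurable_pi_apply 0) measurable_const
    exact (prob_compl_eq_zero_iff hm).2 h0
  have hg0 : ∫⁻ ω, g 0 ω ∂μ ≤ c * (2 * Fintype.card V) := by
    calc ∫⁻ ω, g 0 ω ∂μ ≤ ∫⁻ ω, c * (2 * Fintype.card V) ∂μ := by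
          refine lintegral_mono_ae ?_
          filter_upwards [hae] with ω hω
          simp only [g, CoverTime.rem, hω]
          refine (CoverTime.pot_strip_le G P hP l hchain u).trans ?_
          rw [hl, SimpleGraph.Walk.support_eq_cons, CoverTime.pot, CoverTime.hitLim_self, zero_add]
          gcongr
          have : p.support.tail.length ≤ 2 * Fintype.card V := by simpa using hp
          exact_mod_cast this
      _ = _ := by simp
  calc ∫⁻ ω, T ω ∂μ ≤ ∫⁻ ω, ∑' t, N t ω ∂μ := by
        refine lintegral_mono fun ω => ?_
        rw [hT]
        exact CoverTime.cover_le l hcov ω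
    _ = ∑' t, ∫⁻ ω, N t ω ∂μ := lintegral_tsum fun t => (hN t).aemeasurable
    _ ≤ c * (2 * Fintype.card V) := by
        rw [ENNReal.tsum_eq_iSup_nat]
        exact iSup_le fun t => (le_self_add.trans (hsum t)).trans hg0
    _ = _ := by rw [hc]; ring
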